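/- arXiv:0804.1437 — 2 statements merged into one kernel-verified Lean document; each statement's English description precedes it below -/
import Mathlib

section
/- The set of idempotents of a 0-simple countably compact topological inverse semigroup is finite. -/
/-- A topological space is countably compact if every countable open cover
has a finite subcover. -/
def CountablyCompact (X : Type*) [TopologicalSpace X] : Prop :=
  ∀ U : ℕ → Set X, (∀ n, IsOpen (U n)) → (⋃ n, U n) = Set.univ →
    ∃ t : Finset ℕ, (⋃ n ∈ t, U n) = Set.univ

open Filter Topology

theorem cc_ultra {S : Type*} [TopologicalSpace S] (hcc : CountablyCompact S) (u : ℕ → S) :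
    ∃ (x : S) (U : Ultrafilter ℕ), (U : Filter ℕ) ≤ atTop ∧ Tendsto u U (𝓝 x) := by
  suffices h : ∃ x, MapClusterPt x atTop u by
    obtain ⟨x, hx⟩ := h
    obtain ⟨U, hU, h⟩ := mapClusterPt_iff_ultrafilter.1 hx
    exact ⟨x, U, hU, h⟩
  by_contra hno
  obtain ⟨t, ht⟩ := hcc (fun n => (closure (Set.image u {m | n ≤ m}))ᶜ)
    (fun n => isClosed_closure.isOpen_compl) (by
      rw [Set.eq_univ_iff_forall]
      intro x
      by_contra hx
      apply hno
      refine ⟨x, ?_⟩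
      rw [mapClusterPt_iff_frequently]
      intro s hs
      rw [frequently_atTop]
      intro n
      have hx' : x ∈ closure (Set.image u {m | n ≤ m}) := by
        by_contra h
        exact hx (Set.mem_iUnion.2 ⟨n, h⟩)
      obtain ⟨y, hy, ⟨m, hm, rfl⟩⟩ := mem_closure_iff_nhds.1 hx' s hs
      exact ⟨m, hm, hy⟩)
  have hmem : u (t.sup id) ∈ ⋃ n ∈ t, (closure (Set.image u {m | n ≤ m}))ᶜ := by
    rw [ht]; trivial
  simp only [Set.mem_iUnion] at hmem
  obtain ⟨n, hn, h⟩ := hmem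
  exact h (subset_closure ⟨_, Finset.le_sup (f := id) hn, rfl⟩)

theorem inv_unique_aux {S : Type*} [Semigroup S]
    (hidem : ∀ e f : S, e * e = e → f * f = f → e * f = f * e)
    (a b c : S) (h1 : a * b * a = a) (h2 : b * a * b = b)
    (h3 : a * c * a = a) (h4 : c * a * c = c) : b = c := by
  have hb : (b * a) * (b * a) = b * a := by rw [← mul_assoc, h2]
  have hc : (c * a) * (c * a) = c * a := by rw [← mul_assoc, h4]
  have hb' : (a * b) * (a * b) = a * b := by rw [← mul_assoc, h1]
  have hc' : (a * c) * (a * c) = a * c := by rw [← mul_assoc, h3]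
  have e1 : b = c * a * b := by
    calc b = b * a * b := h2.symm
      _ = b * (a * c * a) * b := by rw [h3]
      _ = (b * a) * (c * a) * b := by simp only [mul_assoc]
      _ = (c * a) * (b * a) * b := by rw [hidem _ _ hb hc]
      _ = c * a * (b * a * b) := by simp only [mul_assoc]
      _ = c * a * b := by rw [h2]
  have e2 : c = c * a * b := by
    calc c = c * a * c := h4.symm
      _ = c * (a * b * a) * c := by rw [h1]
      _ = c * ((a * b) * (a * c)) := by simp only [mul_assoc]
      _ = c * ((a * c) * (a * b)) := by rw [hidem _ _ hb' hc']
      _ = c * a * c * a * b := by simp only [mul_assoc]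
      _ = c * a * b := by rw [h4]
  rw [e1, ← e2]

/-- Powers of `p` starting with the idempotent `e`. -/
def lpow {S : Type*} [Semigroup S] (e p : S) : ℕ → S
  | 0 => e
  | n + 1 => p * lpow e p n

theorem lpow_comm {S : Type*} [Semigroup S] (e p : S) (h : p * e = e * p) (n : ℕ) :
    p * lpow e p n = lpow e p n * p := by
  induction n with
  | zero => exact h
  | succ n ih =>
    show p * (p * lpow e p n) = p * lpow e p n * p
    rw [mul_assoc, ← ih]

theorem no_bicyclic {S : Type*} [Semigroup S] [TopologicalSpace S] [T2Space S]
    (inv : S → S)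
    (hinv1 : ∀ a : S, a * inv a * a = a)
    (hinv2 : ∀ a : S, inv a * a * inv a = inv a)
    (hidem : ∀ e f : S, e * e = e → f * f = f → e * f = f * e)
    (hmulc : Continuous fun p : S × S => p.1 * p.2)
    (hinvc : Continuous inv)
    (hcc : CountablyCompact S) (e p q : S) (hee : e * e = e)
    (hpq : p * q = e) (hep : e * p = p) (hpe : p * e = p) (heq : e * q = q) (hqe : q * e = q) :
    q * p = e := by
  set P := lpow e p with hP
  set Q := lpow e q with hQ
  have P0 : P 0 = e := rfl
  have Q0 : Q 0 = e := rfl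
  have PS : ∀ n, P (n + 1) = p * P n := fun n => rfl
  have QS : ∀ n, Q (n + 1) = q * Q n := fun n => rfl
  have PS' : ∀ n, P (n + 1) = P n * p := fun n => lpow_comm e p (hpe.trans hep.symm) n
  have QS' : ∀ n, Q (n + 1) = Q n * q := fun n => lpow_comm e q (hqe.trans heq.symm) n
  have eP : ∀ n, e * P n = P n := by
    intro n; cases n with
    | zero => exact hee
    | succ n => rw [PS, ← mul_assoc, hep]
  have Qe : ∀ n, Q n * e = Q n := by
    intro n; cases n with
    | zero => exact hee
    | succ n => rw [QS', mul_assoc, hqe]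
  have PQ : ∀ n, P n * Q n = e := by
    intro n; induction n with
    | zero => exact hee
    | succ n ih =>
      rw [PS, QS', mul_assoc, ← mul_assoc (P n), ih, ← mul_assoc, hpe, hpq]
  have invP : ∀ n, inv (P n) = Q n := fun n =>
    inv_unique_aux hidem (P n) _ _ (hinv1 _) (hinv2 _) (by rw [PQ, eP])
      (by rw [mul_assoc, PQ, Qe])
  have Estep : ∀ n, Q n * P n * (Q (n+1) * P (n+1)) = Q (n+1) * P (n+1) := by
    intro n
    calc Q n * P n * (Q (n+1) * P (n+1)) = Q n * (P n * Q n) * (q * P (n+1)) := by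
          rw [QS']; simp only [mul_assoc]
      _ = Q (n+1) * P (n+1) := by rw [PQ, Qe, QS', mul_assoc]
  have Eidem : ∀ n, Q n * P n * (Q n * P n) = Q n * P n := by
    intro n
    calc _ = Q n * (P n * Q n) * P n := by simp only [mul_assoc]
      _ = _ := by rw [PQ, Qe]
  have Emono : ∀ n m, n ≤ m → Q n * P n * (Q m * P m) = Q m * P m := by
    intro n m h
    induction m, h using Nat.le_induction with
    | base => exact Eidem n
    | succ m hm ih =>
      rw [← Estep m, ← mul_assoc, ih]
  obtain ⟨x, U, hU, hx⟩ := cc_ultra hcc P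
  have tmul : ∀ {u v : ℕ → S} {a b : S}, Tendsto u U (𝓝 a) → Tendsto v U (𝓝 b) →
      Tendsto (fun n => u n * v n) U (𝓝 (a * b)) := by
    intro u v a b hu hv
    exact (hmulc.tendsto (a, b)).comp (hu.prodMk_nhds hv)
  have tc : ∀ a : S, Tendsto (fun _ : ℕ => a) U (𝓝 a) := fun a => tendsto_const_nhds
  have hix : Tendsto Q U (𝓝 (inv x)) := by
    have := (hinvc.tendsto x).comp hx
    refine this.congr (fun n => invP n)
  have hxe : x * inv x = e :=
    tendsto_nhds_unique (tmul hx hix) ((tc e).congr fun n => (PQ n).symm)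
  obtain ⟨f, hf⟩ : ∃ f, f = inv x * x := ⟨_, rfl⟩
  have hE : Tendsto (fun n => Q n * P n) U (𝓝 f) := hf ▸ tmul hix hx
  have hff : f * f = f := by rw [hf, ← mul_assoc, hinv2]
  have hE' : Tendsto (fun n => Q (n+1) * P (n+1)) U (𝓝 (q * f * p)) := by
    refine (tmul (tmul (tc q) hE) (tc p)).congr fun n => ?_
    rw [QS, PS']; simp only [mul_assoc]
  have Enf : ∀ n, Q n * P n * f = f := fun n => by
    refine tendsto_nhds_unique (tmul (tc _) hE) (hE.congr' ?_)
    filter_upwards [hU (eventually_ge_atTop n)] with m hm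
    exact (Emono n m hm).symm
  have Enf' : ∀ n, Q n * P n * (q * f * p) = q * f * p := fun n => by
    refine tendsto_nhds_unique (tmul (tc _) hE') (hE'.congr' ?_)
    filter_upwards [hU (eventually_ge_atTop n)] with m hm
    exact (Emono n (m+1) (by omega)).symm
  have ef : e * f = f := by
    have := Enf 0
    rwa [P0, Q0, hee] at this
  have h1 : f * (q * f * p) = q * f * p :=
    tendsto_nhds_unique (tmul hE (tc _)) ((tc _).congr fun n => (Enf' n).symm)
  have h2 : (q * f * p) * f = f :=
    tendsto_nhds_unique (tmul hE' (tc _)) ((tc _).congr fun n => (Enf (n+1)).symm)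
  have fe : f * e = f := by rw [hidem _ _ hff hee, ef]
  have h3 : (q * f * p) * (q * f * p) = q * f * p := by
    calc _ = q * (f * (p * q) * f) * p := by simp only [mul_assoc]
      _ = _ := by rw [hpq, fe, hff]
  have h4 : q * f * p = f := by
    rw [← h1, hidem _ _ hff h3, h2]
  have pf : p * f = f * p := by
    calc p * f = p * (q * f * p) := by rw [h4]
      _ = (p * q) * f * p := by simp only [mul_assoc]
      _ = f * p := by rw [hpq, ef]
  have Pf : ∀ n, P n * f = f * P n := by
    intro n; induction n with
    | zero => rw [P0, ef, fe]
    | succ n ih => rw [PS, mul_assoc, ih, ← mul_assoc, pf, mul_assoc]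
  have xf : x * f = f * x :=
    tendsto_nhds_unique (tmul hx (tc f)) ((tmul (tc f) hx).congr fun n => (Pf n).symm)
  have fx : f * x = x := by rw [← xf, hf, ← mul_assoc, hinv1]
  have hfe : f = e := by rw [← fe, ← hxe, ← mul_assoc, fx]
  have := Enf 1
  rw [PS, QS, P0, Q0, hpe, hqe, hfe, mul_assoc, hpe] at this
  exact this

/-- The set of idempotents of a 0-simple countably compact topological inverse
semigroup is finite. -/
theorem idempotents_finite_of_zero_simple_countably_compact
    {S : Type*} [Semigroup S] [TopologicalSpace S] [T2Space S]
    (inv : S → S)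
    (hinv1 : ∀ a : S, a * inv a * a = a)
    (hinv2 : ∀ a : S, inv a * a * inv a = inv a)
    (hidem : ∀ e f : S, e * e = e → f * f = f → e * f = f * e)
    (hmulc : Continuous fun p : S × S => p.1 * p.2)
    (hinvc : Continuous inv)
    (hcc : CountablyCompact S)
    (z : S) (hz : ∀ x : S, z * x = z ∧ x * z = z)
    (hSS : ∃ a b : S, a * b ≠ z)
    (hideal : ∀ I : Set S, I.Nonempty →
      (∀ i ∈ I, ∀ s : S, s * i ∈ I ∧ i * s ∈ I) → I = {z} ∨ I = Set.univ) :
    {e : S | e * e = e}.Finite := by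
  have hii1 : ∀ a, a * inv a * (a * inv a) = a * inv a := fun a => by rw [← mul_assoc, hinv1]
  have hii2 : ∀ a, inv a * a * (inv a * a) = inv a * a := fun a => by rw [← mul_assoc, hinv2]
  -- linking any two nonzero idempotents
  have link : ∀ e f : S, e * e = e → f * f = f → f ≠ z →
      ∃ c, c * inv c = e ∧ c * f = c ∧ e * c = c := by
    intro e f he hf hfz
    have hI := hideal {s | ∃ a b, s = a * f * b} ⟨f, f, f, by rw [hf, hf]⟩ (by
      rintro i ⟨a, b, rfl⟩ s
      exact ⟨⟨s * a, b, by simp only [mul_assoc]⟩, ⟨a, b * s, by simp only [mul_assoc]⟩⟩)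
    have hfm : f ∈ {s | ∃ a b, s = a * f * b} := ⟨f, f, by rw [hf, hf]⟩
    rcases hI with hI | hI
    · rw [hI] at hfm
      exact absurd hfm hfz
    have hem : e ∈ {s | ∃ a b, s = a * f * b} := by rw [hI]; trivial
    obtain ⟨a, b, hab⟩ := hem
    have hec : e * (e * a * f) = e * a * f := by rw [← mul_assoc, ← mul_assoc, he]
    have hcf : e * a * f * f = e * a * f := by rw [mul_assoc, hf]
    have hcy : (e * a * f) * (b * e) = e := by
      calc _ = e * (a * f * b) * e := by simp only [mul_assoc]
        _ = e := by rw [← hab, he, he]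
    generalize e * a * f = c at hec hcf hcy
    refine ⟨c, ?_, hcf, hec⟩
    have h1 : c * inv c * e = e := by
      rw [← hcy, ← mul_assoc, hinv1]
    have h2 : e * (c * inv c) = c * inv c := by rw [← mul_assoc, hec]
    rw [← h2, hidem _ _ he (hii1 c), h1]
  have gf : ∀ c f, c * f = c → inv c * c * f = inv c * c := fun c f h => by rw [mul_assoc, h]
  have prim : ∀ e f : S, e * e = e → f * f = f → f ≠ z → e * f = f → f = e := by
    intro e f he hf hfz hef
    obtain ⟨c, h1, h2, h3⟩ := link e f he hf hfz
    have hce : c * e = c := by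
      calc c * e = c * f * e := by rw [h2]
        _ = c * (e * f) := by rw [mul_assoc, hidem _ _ hf he]
        _ = c := by rw [hef, h2]
    have hg := no_bicyclic inv hinv1 hinv2 hidem hmulc hinvc hcc e c (inv c) he h1 h3 hce
      (by
        have : inv c * c * e = inv c * c := gf c e hce
        calc e * inv c = e * (inv c * c * inv c) := by rw [hinv2]
          _ = e * (inv c * c) * inv c := by simp only [mul_assoc]
          _ = inv c * c * inv c := by rw [hidem _ _ he (hii2 c), this]
          _ = inv c := hinv2 c)
      (by rw [← h1, ← mul_assoc, hinv2])
    have := gf c f h2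
    rw [hg, hef] at this
    exact this
  have orth : ∀ e f : S, e * e = e → f * f = f → e ≠ f → e * f = z := by
    intro e f he hf hne
    by_contra hz'
    have hi : e * f * (e * f) = e * f := by
      calc e * f * (e * f) = e * (f * e) * f := by simp only [mul_assoc]
        _ = e * (e * f) * f := by rw [hidem _ _ hf he]
        _ = (e * e) * (f * f) := by simp only [mul_assoc]
        _ = e * f := by rw [he, hf]
    have h1 := prim e (e * f) he hi hz' (by rw [← mul_assoc, he])
    have h2 := prim f (e * f) hf hi hz' (by rw [hidem e f he hf, ← mul_assoc, hf])
    exact hne (h1.symm.trans h2)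
  by_contra hinf
  have hinf' : ({e : S | e * e = e} \ {z}).Infinite :=
    Set.Infinite.sdiff hinf (Set.finite_singleton z)
  let u := hinf'.natEmbedding
  have hu1 : ∀ n, (u n : S) * u n = u n := fun n => (u n).2.1
  have hu2 : ∀ n, (u n : S) ≠ z := fun n => (u n).2.2
  have hu3 : ∀ n m, n ≠ m → (u n : S) ≠ u m := fun n m h h' => h (u.injective (Subtype.ext h'))
  have hc : ∀ n, ∃ c, c * inv c = u 0 ∧ inv c * c = u n := by
    intro n
    obtain ⟨c, h1, h2, h3⟩ := link (u 0) (u n) (hu1 0) (hu1 n) (hu2 n)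
    refine ⟨c, h1, prim _ _ (hu1 n) (hii2 c) ?_ ?_⟩
    · intro h
      have : c = z := by rw [← hinv1 c, mul_assoc, h, (hz c).2]
      rw [this, (hz _).1] at h1
      exact hu2 0 h1.symm
    · rw [hidem _ _ (hu1 n) (hii2 c), gf c _ h2]
  choose c hc1 hc2 using hc
  obtain ⟨x, U, hU, hx⟩ := cc_ultra hcc c
  have tmul : ∀ {u v : ℕ → S} {a b : S}, Tendsto u U (𝓝 a) → Tendsto v U (𝓝 b) →
      Tendsto (fun n => u n * v n) U (𝓝 (a * b)) := by
    intro u v a b hu hv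
    exact (hmulc.tendsto (a, b)).comp (hu.prodMk_nhds hv)
  have tc : ∀ a : S, Tendsto (fun _ : ℕ => a) U (𝓝 a) := fun a => tendsto_const_nhds
  have hix : Tendsto (fun n => inv (c n)) U (𝓝 (inv x)) := (hinvc.tendsto x).comp hx
  have hx0 : x * inv x = u 0 :=
    tendsto_nhds_unique (tmul hx hix) ((tc _).congr fun n => (hc1 n).symm)
  have hE : Tendsto (fun n => (u n : S)) U (𝓝 (inv x * x)) := (tmul hix hx).congr hc2
  have hn : ∀ n, (u n : S) * (inv x * x) = z := fun n => by
    refine tendsto_nhds_unique (tmul (tc _) hE) ((tc z).congr' ?_)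
    filter_upwards [hU (eventually_gt_atTop n)] with m hm
    exact (orth _ _ (hu1 n) (hu1 m) (hu3 n m (by omega))).symm
  have h0 : inv x * x = z := by
    rw [← hii2 x]
    exact tendsto_nhds_unique (tmul hE (tc _)) ((tc z).congr fun n => (hn n).symm)
  have : x = z := by rw [← hinv1 x, mul_assoc, h0, (hz x).2]
  rw [this, (hz _).1] at hx0
  exact hu2 0 hx0.symm
end

section
/- Let S be a 0-simple countably compact topological inverse semigroup. Then the Stone–Čech compactification βS of S admits a continuous multiplication and a continuous inversion making βS a 0-simple topological inverse semigroup (with zero the image of the zero of S) such that the canonical map η : S → βS is a multiplication- and inversion-preserving topological embedding. -/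
section Helpers

open Filter Topology Set Pointwise

theorem cc_cluster {X : Type*} [TopologicalSpace X] (h : CountablyCompact X) (u : ℕ → X) :
    ∃ x, ∃ U : Ultrafilter ℕ, (U : Filter ℕ) ≤ atTop ∧ Tendsto u U (𝓝 x) := by
  suffices ∃ x, MapClusterPt x atTop u by
    obtain ⟨x, hx⟩ := this
    exact ⟨x, mapClusterPt_iff_ultrafilter.1 hx⟩
  by_contra hcon
  push Not at hcon
  let C : ℕ → Set X := fun m => closure (u '' Ici m)
  obtain ⟨t, ht⟩ := h (fun m => (C m)ᶜ) (fun m => isClosed_closure.isOpen_compl) (by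
    rw [eq_univ_iff_forall]
    intro x
    have hx := hcon x
    rw [mapClusterPt_iff_frequently] at hx
    push Not at hx
    obtain ⟨s, hs, hs'⟩ := hx
    rw [eventually_atTop] at hs'
    obtain ⟨m, hm⟩ := hs'
    refine mem_iUnion.2 ⟨m, fun hxm => ?_⟩
    obtain ⟨y, hy, n, hn, rfl⟩ := mem_closure_iff_nhds.1 hxm s hs
    exact hm n hn hy)
  have h1 : u (t.sup id) ∈ ⋃ n ∈ t, (C n)ᶜ := by rw [ht]; trivial
  simp only [mem_iUnion] at h1
  obtain ⟨n, hn, hn'⟩ := h1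
  exact hn' (subset_closure ⟨_, Finset.le_sup (f := id) hn, rfl⟩)

theorem cc_range {X Y : Type*} [TopologicalSpace X] [MetricSpace Y] (h : CountablyCompact X)
    (F : X → Y) (hF : Continuous F) : IsCompact (range F) := by
  apply IsSeqCompact.isCompact
  intro u hu
  choose v hv using hu
  obtain ⟨x, U, hU, hx⟩ := cc_cluster h v
  have h2 : MapClusterPt (F x) atTop u := by
    rw [mapClusterPt_iff_ultrafilter]
    refine ⟨U, hU, ?_⟩
    have : u = F ∘ v := by ext n; exact (hv n).symm
    rw [this]
    exact (hF.tendsto x).comp hx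
  obtain ⟨ψ, hψ, h3⟩ := h2.tendsto_subseq
  exact ⟨F x, ⟨x, rfl⟩, ψ, hψ, h3⟩

theorem cc_closed {X : Type*} [TopologicalSpace X] (h : CountablyCompact X) (s : Set X)
    (hs : IsClosed s) : CountablyCompact s := by
  intro U hU hc
  choose V hV hVU using fun n => isOpen_induced_iff.1 (hU n)
  obtain ⟨t, ht⟩ := h (fun n => V n ∪ sᶜ) (fun n => (hV n).union hs.isOpen_compl) (by
    rw [eq_univ_iff_forall]
    intro x
    by_cases hx : x ∈ s
    · have : (⟨x, hx⟩ : s) ∈ ⋃ n, U n := by rw [hc]; trivial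
      obtain ⟨n, hn⟩ := mem_iUnion.1 this
      rw [← hVU] at hn
      exact mem_iUnion.2 ⟨n, Or.inl hn⟩
    · exact mem_iUnion.2 ⟨0, Or.inr hx⟩)
  refine ⟨t, ?_⟩
  rw [eq_univ_iff_forall]
  rintro ⟨x, hx⟩
  have : x ∈ ⋃ n ∈ t, (V n ∪ sᶜ) := by rw [ht]; trivial
  simp only [mem_iUnion] at this ⊢
  obtain ⟨n, hn, hn'⟩ := this
  refine ⟨n, hn, ?_⟩
  rw [← hVU]
  exact hn'.resolve_right (fun h => h hx)

/-- Continuous functions on countably compact groups are uniformly continuous. -/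
theorem group_unif {G : Type*} [Group G] [TopologicalSpace G] [IsTopologicalGroup G]
    (h : CountablyCompact G) (f : G → ℝ) (hf : Continuous f) (ε : ℝ) (hε : 0 < ε) :
    ∀ᶠ g in 𝓝 (1 : G), ∀ y, |f (g * y) - f y| < ε := by
  by_contra hcon
  have key : ∀ V ∈ 𝓝 (1 : G), ∃ g ∈ V, ∃ y, ε ≤ |f (g * y) - f y| := by
    intro V hV
    by_contra hc
    push Not at hc
    exact hcon (Filter.mem_of_superset hV hc)
  choose! g hgV y hy using key
  have hosc : ∀ (x : G) (δ : ℝ), 0 < δ → ∀ᶠ v in 𝓝 (1 : G), |f (v * x) - f x| < δ := by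
    intro x δ hδ
    have : Continuous fun v : G => |f (v * x) - f x| := by fun_prop
    have h1 := this.tendsto 1
    simp only [one_mul, sub_self, abs_zero] at h1
    exact h1.eventually (gt_mem_nhds hδ)
  have step : ∀ V : {V : Set G // V ∈ 𝓝 (1 : G)}, ∃ W : {V : Set G // V ∈ 𝓝 (1 : G)},
      IsClosed W.1 ∧ (W.1)⁻¹ = W.1 ∧ W.1 * W.1 ⊆ V.1 ∧
      (∀ v ∈ W.1, |f (v * y V.1) - f (y V.1)| < ε / 4) ∧
      (∀ v ∈ W.1, |f (v * (g V.1 * y V.1)) - f (g V.1 * y V.1)| < ε / 4) := by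
    rintro ⟨V, hV⟩
    have hA : V ∩ ({v | |f (v * y V) - f (y V)| < ε / 4} ∩
        {v | |f (v * (g V * y V)) - f (g V * y V)| < ε / 4}) ∈ 𝓝 (1 : G) :=
      inter_mem hV (inter_mem (hosc _ _ (by positivity)) (hosc _ _ (by positivity)))
    obtain ⟨W, hW, hWc, hWs, hWW⟩ := exists_closed_nhds_one_inv_eq_mul_subset hA
    have h1 : ∀ v ∈ W, v ∈ V ∩ ({v | |f (v * y V) - f (y V)| < ε / 4} ∩
        {v | |f (v * (g V * y V)) - f (g V * y V)| < ε / 4}) := fun v hv =>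
      hWW (Set.mem_mul.2 ⟨v, hv, 1, mem_of_mem_nhds hW, mul_one v⟩)
    exact ⟨⟨W, hW⟩, hWc, hWs, fun v hv => (hWW hv).1, fun v hv => (h1 v hv).2.1,
      fun v hv => (h1 v hv).2.2⟩
  choose W hWc hWi hWW hW1 hW2 using step
  let V : ℕ → {V : Set G // V ∈ 𝓝 (1 : G)} := fun n => Nat.rec ⟨univ, univ_mem⟩ (fun _ v => W v) n
  have hVs : ∀ n, V (n + 1) = W (V n) := fun n => rfl
  have h1V : ∀ n, (1 : G) ∈ (V n).1 := fun n => mem_of_mem_nhds (V n).2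
  have hsub : ∀ n, (V (n + 1)).1 ⊆ (V n).1 := fun n v hv =>
    hWW (V n) (Set.mem_mul.2 ⟨v, hv, 1, h1V (n + 1), mul_one v⟩)
  have hanti : Antitone fun n => (V n).1 := antitone_nat_of_succ_le hsub
  have hVc : ∀ n, IsClosed (V n).1 := by
    intro n
    cases n with
    | zero => exact isClosed_univ
    | succ n => exact hWc _
  have hVi : ∀ n, ((V n).1)⁻¹ = (V n).1 := by
    intro n
    cases n with
    | zero => exact inv_univ
    | succ n => exact hWi _
  let x : ℕ → G := fun n => y (V n).1
  let γ : ℕ → G := fun n => g (V n).1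
  obtain ⟨x₀, U, hU, hx₀⟩ := cc_cluster h x
  obtain ⟨Ω, hΩ, hΩo, h1Ω⟩ := eventually_nhds_iff.1 (hosc x₀ (ε / 4) (by positivity))
  -- the intersection of the `V n` translates of `Ω` contains some `V m`
  have hm : ∃ m, ∀ v ∈ (V m).1, ∃ n ∈ ⋂ k, (V k).1, n * v ∈ Ω := by
    by_contra hc
    push Not at hc
    choose v hvV hv using hc
    obtain ⟨w, U', hU', hw⟩ := cc_cluster h v
    have hwN : w ∈ ⋂ k, (V k).1 := by
      refine mem_iInter.2 fun k => ?_
      refine (hVc k).mem_of_tendsto hw ?_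
      filter_upwards [hU' (Ici_mem_atTop k)] with n hn
      exact hanti hn (hvV n)
    have hwi : w⁻¹ ∈ ⋂ k, (V k).1 := by
      refine mem_iInter.2 fun k => ?_
      rw [← hVi k]
      simpa using mem_iInter.1 hwN k
    have : Tendsto (fun n => w⁻¹ * v n) U' (𝓝 (w⁻¹ * w)) := hw.const_mul _
    rw [inv_mul_cancel] at this
    obtain ⟨n, hn⟩ := (this.eventually (hΩo.mem_nhds h1Ω)).exists
    exact hv n _ hwi hn
  obtain ⟨m, hm⟩ := hm
  have hxx : Tendsto (fun n => x n * x₀⁻¹) U (𝓝 1) := by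
    have := hx₀.mul_const x₀⁻¹
    rwa [mul_inv_cancel] at this
  obtain ⟨n, hn1, hn2⟩ := ((hxx.eventually (V (m + 1)).2).and (hU (Ici_mem_atTop (m + 1)))).exists
  have hn2 : m + 1 ≤ n := hn2
  obtain ⟨a, ha, ha'⟩ := hm _ (hsub m hn1)
  obtain ⟨b, hb, hb'⟩ := hm (γ n * (x n * x₀⁻¹))
    (hWW (V m) (Set.mul_mem_mul (hanti hn2 (hgV _ (V n).2)) hn1))
  have e1 := hΩ _ ha'
  have e2 := hΩ _ hb'
  have e3 := hW1 (V n) a (mem_iInter.1 ha (n + 1))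
  have e4 := hW2 (V n) b (mem_iInter.1 hb (n + 1))
  have e5 := hy (V n).1 (V n).2
  change |f (a * x n) - f (x n)| < _ at e3
  change |f (b * (γ n * x n)) - f (γ n * x n)| < _ at e4
  change _ ≤ |f (γ n * x n) - f (x n)| at e5
  simp only [mul_assoc, inv_mul_cancel, mul_one] at e1 e2
  rw [abs_lt] at e1 e2 e3 e4
  rw [le_abs] at e5
  rcases e5 with e5 | e5 <;> linarith [e1.1, e1.2, e2.1, e2.2, e3.1, e3.2, e4.1, e4.2]

/-- All the hypotheses of the main theorem, bundled. -/
structure Hyp (S : Type*) [Semigroup S] [TopologicalSpace S] (inv : S → S) (z : S) : Prop where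
  hinv1 : ∀ a : S, a * inv a * a = a
  hinv2 : ∀ a : S, inv a * a * inv a = inv a
  hidem : ∀ e f : S, e * e = e → f * f = f → e * f = f * e
  hmulc : Continuous fun p : S × S => p.1 * p.2
  hinvc : Continuous inv
  hcc : CountablyCompact S
  hz : ∀ x : S, z * x = z ∧ x * z = z
  hSS : ∃ a b : S, a * b ≠ z
  hideal : ∀ I : Set S, I.Nonempty →
      (∀ i ∈ I, ∀ s : S, s * i ∈ I ∧ i * s ∈ I) → I = {z} ∨ I = Set.univ

set_option linter.unusedSectionVars false

namespace Hyp

variable {S : Type*} [Semigroup S] [TopologicalSpace S] [T2Space S] {inv : S → S} {z : S}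

theorem idl (H : Hyp S inv z) (a : S) : (a * inv a) * (a * inv a) = a * inv a := by
  rw [← mul_assoc, H.hinv1]

theorem idr (H : Hyp S inv z) (a : S) : (inv a * a) * (inv a * a) = inv a * a := by
  rw [← mul_assoc, H.hinv2]

theorem inv_unique (H : Hyp S inv z) (a b : S) (h1 : a * b * a = a) (h2 : b * a * b = b) :
    b = inv a := by
  have hab : (a * b) * (a * b) = a * b := by rw [← mul_assoc, h1]
  have hba : (b * a) * (b * a) = b * a := by rw [← mul_assoc, h2]
  have e1 : a * b = a * inv a := by
    calc a * b = (a * inv a) * (a * b) := by rw [← mul_assoc, H.hinv1]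
      _ = (a * b) * (a * inv a) := H.hidem _ _ (H.idl a) hab
      _ = a * inv a := by rw [← mul_assoc, h1]
  have e2 : b * a = inv a * a := by
    calc b * a = (b * a) * (inv a * a) := by rw [mul_assoc, ← mul_assoc a, H.hinv1]
      _ = (inv a * a) * (b * a) := H.hidem _ _ hba (H.idr a)
      _ = inv a * a := by rw [mul_assoc, ← mul_assoc a, h1]
  calc b = b * a * b := h2.symm
    _ = inv a * (a * b) := by rw [e2, mul_assoc]
    _ = inv a := by rw [e1, ← mul_assoc, H.hinv2]

theorem inv_inv (H : Hyp S inv z) (a : S) : inv (inv a) = a :=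
  (H.inv_unique _ _ (H.hinv2 a) (H.hinv1 a)).symm

theorem inv_idem (H : Hyp S inv z) (e : S) (he : e * e = e) : inv e = e :=
  (H.inv_unique e e (by rw [he, he]) (by rw [he, he])).symm

theorem inv_mul (H : Hyp S inv z) (a b : S) : inv (a * b) = inv b * inv a := by
  have hc := H.hidem _ _ (H.idl b) (H.idr a)
  refine (H.inv_unique _ _ ?_ ?_).symm
  · calc a * b * (inv b * inv a) * (a * b) = a * ((b * inv b) * (inv a * a)) * b := by
          simp only [mul_assoc]
      _ = (a * inv a * a) * (b * inv b * b) := by rw [hc]; simp only [mul_assoc]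
      _ = a * b := by rw [H.hinv1, H.hinv1]
  · calc inv b * inv a * (a * b) * (inv b * inv a)
          = inv b * ((inv a * a) * (b * inv b)) * inv a := by simp only [mul_assoc]
      _ = (inv b * b * inv b) * (inv a * a * inv a) := by rw [← hc]; simp only [mul_assoc]
      _ = inv b * inv a := by rw [H.hinv2, H.hinv2]

theorem cont_mul (H : Hyp S inv z) {X : Type*} [TopologicalSpace X] {f g : X → S}
    (hf : Continuous f) (hg : Continuous g) : Continuous fun x => f x * g x :=
  H.hmulc.comp (hf.prodMk hg)

theorem tend_mul (H : Hyp S inv z) {X : Type*} {l : Filter X} {f g : X → S} {a b : S}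
    (hf : Tendsto f l (𝓝 a)) (hg : Tendsto g l (𝓝 b)) :
    Tendsto (fun x => f x * g x) l (𝓝 (a * b)) :=
  (H.hmulc.tendsto (a, b)).comp (hf.prodMk_nhds hg)

theorem exists_mul (H : Hyp S inv z) (e : S) (he : e ≠ z) (h : e * inv e = e ∨ e * e = e) (s : S) :
    ∃ x y, s = x * e * y := by
  have hmem : e ∈ {s | ∃ x y, s = x * e * y} := by
    rcases h with h | h
    · refine ⟨e * inv e, inv e * e, ?_⟩
      simp only [← mul_assoc]; rw [H.hinv1, H.hinv1]
    · exact ⟨e, e, by rw [h, h]⟩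
  have := H.hideal {s | ∃ x y, s = x * e * y} ⟨e, hmem⟩ (by
    rintro _ ⟨x, y, rfl⟩ t
    exact ⟨⟨t * x, y, by simp only [mul_assoc]⟩, ⟨x, y * t, by simp only [mul_assoc]⟩⟩)
  rcases this with h | h
  · rw [h] at hmem; exact absurd hmem he
  · have : s ∈ {s | ∃ x y, s = x * e * y} := by rw [h]; trivial
    exact this

theorem eq_zero_of_left (H : Hyp S inv z) (a : S) (h : a * inv a = z) : a = z := by
  rw [← H.hinv1 a, h, (H.hz a).1]

theorem eq_zero_of_right (H : Hyp S inv z) (a : S) (h : inv a * a = z) : a = z := by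
  rw [← H.hinv1 a, mul_assoc, h, (H.hz a).2]

/-- There are no bicyclic subsemigroups. -/
theorem no_bicyclic (H : Hyp S inv z) (e a : S) (he : e * e = e) (hea : e * a = a)
    (hae : a * e = a) (h : a * inv a = e) : inv a * a = e := by
  set b := inv a with hb
  set p := b * a with hp
  have heb : e * b = b := by
    have := H.inv_mul a e
    rw [hae, H.inv_idem e he] at this; exact this.symm
  have hbe : b * e = b := by
    have := H.inv_mul e a
    rw [hea, H.inv_idem e he] at this; exact this.symm
  -- powers
  let A : ℕ → S := fun n => Nat.rec e (fun _ x => a * x) n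
  have hA : ∀ n, A (n + 1) = a * A n := fun n => rfl
  have hA' : ∀ n, A (n + 1) = A n * a := by
    intro n
    induction n with
    | zero => change a * e = e * a; rw [hae, hea]
    | succ n ih => rw [hA (n + 1)]; nth_rw 1 [ih]; rw [hA n, mul_assoc]
  have hAe : ∀ n, e * A n = A n := by
    intro n
    cases n with
    | zero => exact he
    | succ n => rw [hA, ← mul_assoc, hea]
  have hAB : ∀ n, A n * inv (A n) = e := by
    intro n
    induction n with
    | zero => change e * inv e = e; rw [H.inv_idem e he, he]
    | succ n ih =>
      rw [hA, H.inv_mul]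
      calc a * A n * (inv (A n) * b) = a * ((A n * inv (A n)) * b) := by simp only [mul_assoc]
        _ = e := by rw [ih, heb, h]
  let P : ℕ → S := fun n => inv (A n) * A n
  have hPP : ∀ n, P n * P n = P n := fun n => H.idr (A n)
  have hP1 : ∀ n, a * P (n + 1) * b = P n := by
    intro n
    change a * (inv (A (n + 1)) * A (n + 1)) * b = inv (A n) * A n
    rw [hA' n, H.inv_mul]
    calc a * (b * inv (A n) * (A n * a)) * b = (a * b) * (inv (A n) * A n) * (a * b) := by
          simp only [mul_assoc]
      _ = (e * inv (A n)) * (A n * e) := by rw [h]; simp only [mul_assoc]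
      _ = inv (A n) * A n := by
        have h1 : A n * e = A n := by
          cases n with
          | zero => exact he
          | succ n => rw [hA', mul_assoc, hae]
        have h2 : e * inv (A n) = inv (A n) := by
          have := H.inv_mul (A n) e
          rw [h1, H.inv_idem e he] at this; exact this.symm
        rw [h1, h2]
  have hPs : ∀ n, P (n + 1) * P n = P (n + 1) := by
    intro n
    change inv (A (n + 1)) * A (n + 1) * (inv (A n) * A n) = inv (A (n + 1)) * A (n + 1)
    rw [hA n, mul_assoc (inv _), mul_assoc a, ← mul_assoc (A n), H.hinv1]
  have hPk : ∀ k n, k ≤ n → P n * P k = P n := by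
    intro k n hkn
    induction n, hkn using Nat.le_induction with
    | base => exact hPP k
    | succ n hn ih => rw [← hPs n, mul_assoc, ih]
  obtain ⟨c, U, hU, hc⟩ := cc_cluster H.hcc A
  have hci : Tendsto (fun n => inv (A n)) U (𝓝 (inv c)) := (H.hinvc.tendsto c).comp hc
  set q := inv c * c with hq
  have hPq : Tendsto P U (𝓝 q) := H.tend_mul hci hc
  have hcc : c * inv c = e := by
    refine tendsto_nhds_unique (H.tend_mul hc hci) ?_
    simp only [hAB]
    exact tendsto_const_nhds
  have hqq : q * q = q := H.idr c
  have hqP : ∀ k, q * P k = q := by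
    intro k
    refine tendsto_nhds_unique (H.tend_mul hPq tendsto_const_nhds) (hPq.congr' ?_)
    filter_upwards [hU (Ici_mem_atTop k)] with n hn
    exact (hPk k n hn).symm
  -- the limit of the shifted sequence
  set r := a * q * b with hr
  have hPr : Tendsto (fun n => P (n - 1)) U (𝓝 r) := by
    have : Tendsto (fun n => a * P n * b) U (𝓝 r) :=
      H.tend_mul (H.tend_mul tendsto_const_nhds hPq) tendsto_const_nhds
    refine this.congr' ?_
    filter_upwards [hU (Ici_mem_atTop 1)] with n hn
    have hn : 1 ≤ n := hn
    obtain ⟨m, rfl⟩ := Nat.exists_eq_add_of_le' hn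
    exact hP1 m
  have hrP : ∀ k, r * P k = r := by
    intro k
    refine tendsto_nhds_unique (H.tend_mul hPr tendsto_const_nhds) (hPr.congr' ?_)
    filter_upwards [hU (Ici_mem_atTop (k + 1))] with n hn
    have hn : k + 1 ≤ n := hn
    exact (hPk k (n - 1) (by omega)).symm
  have hrr : r * r = r := by
    refine tendsto_nhds_unique (H.tend_mul hPr hPr) (hPr.congr fun n => (hPP _).symm)
  have hqr : q * r = q := by
    refine tendsto_nhds_unique (H.tend_mul tendsto_const_nhds hPr) ?_
    simp only [hqP]
    exact tendsto_const_nhds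
  have hrq : r * q = r := by
    refine tendsto_nhds_unique (H.tend_mul tendsto_const_nhds hPq) ?_
    simp only [hrP]
    exact tendsto_const_nhds
  have hrq' : r = q := by rw [← hrq, H.hidem r q hrr hqq, hqr]
  have hP1p : P 1 = p := by
    change inv (a * e) * (a * e) = p
    rw [hae]
  have hqp : q * p = q := by rw [← hP1p, hqP]
  have hqe : q * e = q := by
    have := hqP 0
    change q * (inv e * e) = q at this
    rwa [H.inv_idem e he, he] at this
  have hcomm : q * a = a * q := by
    have h1 : q * a = a * q * p := by
      nth_rw 1 [← hrq']
      rw [hr, hp]; simp only [mul_assoc]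
    rw [h1, mul_assoc, hqp]
  have hqA : ∀ n, q * A n = A n * q := by
    intro n
    induction n with
    | zero => exact H.hidem q e hqq he
    | succ n ih => rw [hA, ← mul_assoc, hcomm, mul_assoc, ih, mul_assoc]
  have hqc : q * c = c * q := by
    refine tendsto_nhds_unique (H.tend_mul tendsto_const_nhds hc) ?_
    simp only [hqA]
    exact H.tend_mul hc tendsto_const_nhds
  have hcq : c * q = c := by rw [hq, ← mul_assoc, H.hinv1]
  have hqe' : q = e := by
    rw [← hqe, ← hcc, ← mul_assoc, hqc, hcq]
  have hpe : p * e = p := by rw [hp, mul_assoc, hae]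
  have hpp : p * p = p := H.idr a
  calc p = p * e := hpe.symm
    _ = e * p := H.hidem _ _ hpp he
    _ = e := by rw [← hqe', hqp]

/-- Idempotents are primitive. -/
theorem primitive (H : Hyp S inv z) (e f : S) (he : e * e = e) (hf : f * f = f) (hfz : f ≠ z)
    (hef : e * f = f) : e = f := by
  have hfe : f * e = f := by rw [← H.hidem e f he hf, hef]
  obtain ⟨x, y, hxy⟩ := H.exists_mul f hfz (Or.inr hf) e
  set a := e * x * f with ha
  set b := f * y * e with hb
  have hab : a * b = e := by
    calc a * b = e * (x * (f * f) * y) * e := by rw [ha, hb]; simp only [mul_assoc]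
      _ = e := by rw [hf, ← hxy, he, he]
  have hea : e * a = a := by rw [ha]; simp only [← mul_assoc]; rw [he]
  have haf : a * f = a := by rw [ha, mul_assoc, hf]
  have hae : a * e = a := by
    calc a * e = a * (f * e) := by rw [← mul_assoc, haf]
      _ = a := by rw [hfe, haf]
  have haa : a * inv a = e := by
    calc a * inv a = e * (a * inv a) := by rw [← mul_assoc, hea]
      _ = (a * inv a) * e := H.hidem _ _ he (H.idl a)
      _ = a * inv a * a * b := by rw [← hab]; simp only [mul_assoc]
      _ = e := by rw [H.hinv1, hab]
  have := H.no_bicyclic e a he hea hae haa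
  calc e = inv a * (a * f) := by rw [haf, this]
    _ = e * f := by rw [← mul_assoc, this]
    _ = f := hef

theorem left_of_mul (H : Hyp S inv z) (e x : S) (he : e * e = e) (hex : e * x = x) (hx : x ≠ z) :
    x * inv x = e := by
  refine (H.primitive e (x * inv x) he (H.idl x) (fun h => hx (H.eq_zero_of_left x h)) ?_).symm
  rw [← mul_assoc, hex]

theorem right_of_mul (H : Hyp S inv z) (e x : S) (he : e * e = e) (hex : x * e = x) (hx : x ≠ z) :
    inv x * x = e := by
  refine (H.primitive e (inv x * x) he (H.idr x) (fun h => hx (H.eq_zero_of_right x h)) ?_).symm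
  rw [H.hidem _ _ he (H.idr x), mul_assoc, hex]

theorem orth (H : Hyp S inv z) (e f : S) (he : e * e = e) (hf : f * f = f) (hne : e ≠ f) :
    e * f = z := by
  by_contra h
  have hc := H.hidem e f he hf
  have hef : (e * f) * (e * f) = e * f := by
    rw [mul_assoc, ← mul_assoc f, ← hc, mul_assoc e f f, hf, ← mul_assoc, he]
  have h1 := H.primitive e (e * f) he hef h (by rw [← mul_assoc, he])
  have h2 := H.primitive f (e * f) hf hef h (by rw [hc, ← mul_assoc, hf])
  exact hne (h1.trans h2.symm)

theorem connect (H : Hyp S inv z) (e f : S) (he : e * e = e) (hf : f * f = f) (hez : e ≠ z)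
    (hfz : f ≠ z) : ∃ a, a * inv a = e ∧ inv a * a = f := by
  obtain ⟨x, y, hxy⟩ := H.exists_mul f hfz (Or.inr hf) e
  have hne : e * x * f ≠ z := by
    intro h
    apply hez
    calc e = e * (x * f * y) := by rw [← hxy, he]
      _ = e * x * f * y := by simp only [mul_assoc]
      _ = z := by rw [h, (H.hz y).1]
  exact ⟨e * x * f, H.left_of_mul e _ he (by simp only [← mul_assoc]; rw [he]) hne,
    H.right_of_mul f _ hf (by rw [mul_assoc, hf]) hne⟩

theorem finite_idem (H : Hyp S inv z) : {e : S | e * e = e}.Finite := by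
  by_contra hinf
  have hinf : {e : S | e * e = e}.Infinite := hinf
  have hinf' : ({e : S | e * e = e} \ {z}).Infinite := hinf.sdiff (finite_singleton z)
  let v := hinf'.natEmbedding
  have hv1 : ∀ n, (v n : S) * v n = v n := fun n => (v n).2.1
  have hv2 : ∀ n, (v n : S) ≠ z := fun n => (v n).2.2
  choose a ha1 ha2 using fun n => H.connect (v n) (v 0) (hv1 n) (hv1 0) (hv2 n) (hv2 0)
  obtain ⟨c, U, hU, hc⟩ := cc_cluster H.hcc a
  have hci : Tendsto (fun n => inv (a n)) U (𝓝 (inv c)) := (H.hinvc.tendsto c).comp hc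
  have h1 : inv c * c = v 0 := by
    refine tendsto_nhds_unique (H.tend_mul hci hc) ?_
    simp only [ha2]
    exact tendsto_const_nhds
  have h2 : Tendsto (fun n => (v n : S)) U (𝓝 (c * inv c)) := by
    have := H.tend_mul hc hci
    simpa only [ha1] using this
  have h3 : ∀ m, (v m : S) * (c * inv c) = z := by
    intro m
    refine tendsto_nhds_unique (H.tend_mul tendsto_const_nhds h2)
      ((tendsto_const_nhds (x := z)).congr' ?_)
    filter_upwards [hU (Ici_mem_atTop (m + 1))] with n hn
    have hn : m + 1 ≤ n := hn
    refine (H.orth _ _ (hv1 m) (hv1 n) fun h => ?_).symm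
    have := v.injective (Subtype.ext h)
    omega
  have h4 : (c * inv c) * (c * inv c) = z := by
    refine tendsto_nhds_unique (H.tend_mul h2 tendsto_const_nhds) ?_
    simp only [h3]
    exact tendsto_const_nhds
  rw [H.idl] at h4
  apply hv2 0
  rw [← h1, H.eq_zero_of_left c h4, (H.hz _).2]

theorem isOpen_left (H : Hyp S inv z) (e : S) : IsOpen {x : S | x * inv x = e} := by
  have h1 : {x : S | x * inv x = e}ᶜ = ⋃ f ∈ {f : S | f * f = f} \ {e}, {x | x * inv x = f} := by
    ext x
    simp only [mem_compl_iff, mem_ofPred_eq, mem_iUnion, Set.mem_sdiff, mem_singleton_iff, exists_prop]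
    constructor
    · intro h; exact ⟨_, ⟨H.idl x, h⟩, rfl⟩
    · rintro ⟨f, ⟨_, h⟩, rfl⟩; exact h
  rw [← isClosed_compl_iff, h1]
  exact (H.finite_idem.sdiff).isClosed_biUnion fun f _ =>
    isClosed_eq (H.cont_mul continuous_id H.hinvc) continuous_const

theorem isOpen_right (H : Hyp S inv z) (e : S) : IsOpen {x : S | inv x * x = e} := by
  have : {x : S | inv x * x = e} = inv ⁻¹' {x : S | x * inv x = e} := by
    ext x; simp only [mem_ofPred_eq, mem_preimage, H.inv_inv]
  rw [this]
  exact (H.isOpen_left e).preimage H.hinvc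

theorem isOpen_zero (H : Hyp S inv z) : IsOpen {z} := by
  have : {z} = {x : S | x * inv x = z} := by
    ext x
    simp only [mem_singleton_iff, mem_ofPred_eq]
    exact ⟨fun h => by rw [h, (H.hz _).1], H.eq_zero_of_left x⟩
  rw [this]
  exact H.isOpen_left z


/-- The maximal subgroup at the idempotent `e`. -/
abbrev G (_ : Hyp S inv z) (e : S) := {g : S // g * inv g = e ∧ inv g * g = e}

theorem G_mul_e (H : Hyp S inv z) {e : S} (g : H.G e) : (g : S) * e = g := by
  have h := H.hinv1 g.1
  rwa [mul_assoc, g.2.2] at h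

theorem e_mul_G (H : Hyp S inv z) {e : S} (g : H.G e) : e * (g : S) = g := by
  have h := H.hinv1 g.1
  rwa [g.2.1] at h

theorem G_ne (H : Hyp S inv z) {e : S} (hez : e ≠ z) (g : H.G e) : (g : S) ≠ z := by
  intro h
  have := g.2.1
  rw [h, (H.hz _).1] at this
  exact hez this.symm

/-- The group structure. -/
@[reducible] def grp (H : Hyp S inv z) (e : S) (he : e * e = e) : Group (H.G e) where
  mul a b := ⟨a.1 * b.1, by
    rw [H.inv_mul]
    constructor
    · calc a.1 * b.1 * (inv b.1 * inv a.1) = a.1 * (b.1 * inv b.1) * inv a.1 := by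
            simp only [mul_assoc]
        _ = e := by rw [b.2.1, H.G_mul_e a, a.2.1]
    · calc inv b.1 * inv a.1 * (a.1 * b.1) = inv b.1 * ((inv a.1 * a.1) * b.1) := by
            simp only [mul_assoc]
        _ = e := by rw [a.2.2, H.e_mul_G b, b.2.2]⟩
  one := ⟨e, by rw [H.inv_idem e he, he]; exact ⟨rfl, rfl⟩⟩
  inv a := ⟨inv a.1, by rw [H.inv_inv]; exact ⟨a.2.2, a.2.1⟩⟩
  mul_assoc a b c := Subtype.ext (mul_assoc a.1 b.1 c.1)
  one_mul a := Subtype.ext (H.e_mul_G a)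
  mul_one a := Subtype.ext (H.G_mul_e a)
  inv_mul_cancel a := Subtype.ext a.2.2

theorem grp_top (H : Hyp S inv z) (e : S) (he : e * e = e) :
    letI := H.grp e he
    IsTopologicalGroup (H.G e) := by
  let _ := H.grp e he
  exact
    { continuous_mul := Continuous.subtype_mk (H.cont_mul
        (continuous_subtype_val.comp continuous_fst) (continuous_subtype_val.comp continuous_snd)) _
      continuous_inv := Continuous.subtype_mk (H.hinvc.comp continuous_subtype_val) _ }

theorem G_clopen (H : Hyp S inv z) (e : S) : IsClopen {g : S | g * inv g = e ∧ inv g * g = e} :=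
  ⟨(isClosed_eq (H.cont_mul continuous_id H.hinvc) continuous_const).inter
    (isClosed_eq (H.cont_mul H.hinvc continuous_id) continuous_const),
    (H.isOpen_left e).inter (H.isOpen_right e)⟩

theorem unif_e (H : Hyp S inv z) (f : S → ℝ) (hf : Continuous f) (e : S) (he : e * e = e)
    (hez : e ≠ z) (ε : ℝ) (hε : 0 < ε) : ∀ᶠ g in 𝓝 e, ∀ y, |f (g * y) - f (e * y)| < ε := by
  let _ := H.grp e he
  have := H.grp_top e he
  have hGcc : CountablyCompact (H.G e) := cc_closed H.hcc _ (H.G_clopen e).1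
  have h1 : ∀ r : S, ∀ᶠ g in 𝓝 e, (g * inv g = e ∧ inv g * g = e) ∧
      ∀ y, y * inv y = e → inv y * y = e → |f (g * (y * r)) - f (y * r)| < ε := by
    intro r
    have hc : Continuous fun g : H.G e => f (g.1 * r) :=
      hf.comp (H.cont_mul continuous_subtype_val continuous_const)
    have h2 := group_unif hGcc _ hc ε hε
    have h3 : map Subtype.val (𝓝 (1 : H.G e)) = 𝓝 e :=
      ((H.G_clopen e).2.isOpenEmbedding_subtypeVal).map_nhds_eq (1 : H.G e)
    rw [← h3, eventually_map]
    filter_upwards [h2] with g hg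
    refine ⟨g.2, fun y hy1 hy2 => ?_⟩
    have := hg ⟨y, hy1, hy2⟩
    rw [← mul_assoc]
    exact this
  have h2 : ∀ d : S, ∃ r, (d * d = d → d ≠ z → r * inv r = e ∧ inv r * r = d) := by
    intro d
    by_cases hd : d * d = d ∧ d ≠ z
    · obtain ⟨r, hr⟩ := H.connect e d he hd.1 hez hd.2
      exact ⟨r, fun _ _ => hr⟩
    · exact ⟨e, fun h h' => absurd ⟨h, h'⟩ hd⟩
  choose r hr using h2
  have h3 := (eventually_all_finite H.finite_idem).2 fun d _ => h1 (r d)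
  filter_upwards [h3] with g hg y
  have hgG := (hg e he).1
  have hge : g * e = g := H.G_mul_e (⟨g, hgG⟩ : H.G e)
  have hgy : g * y = g * (e * y) := by rw [← mul_assoc, hge]
  rw [hgy]
  set u := e * y with hu
  by_cases huz : u = z
  · rw [huz, (H.hz _).2]; simpa using hε
  have heu : e * u = u := by rw [hu, ← mul_assoc, he]
  have hul := H.left_of_mul e u he heu huz
  set d := inv u * u with hd
  have hdd : d * d = d := H.idr u
  have hud : u * d = u := by rw [hd, ← mul_assoc, H.hinv1]
  have hdz : d ≠ z := fun h => huz (H.eq_zero_of_right u h)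
  obtain ⟨hr1, hr2⟩ := hr d hdd hdz
  have hw : u * inv (r d) * r d = u := by rw [mul_assoc, hr2, hud]
  have := (hg d hdd).2 (u * inv (r d)) ?_ ?_
  · rwa [hw] at this
  · rw [H.inv_mul, H.inv_inv, ← mul_assoc, hw, hul]
  · rw [H.inv_mul, H.inv_inv]
    calc r d * inv u * (u * inv (r d)) = r d * (inv u * u) * inv (r d) := by simp only [mul_assoc]
      _ = e := by 
        rw [← hd]
        nth_rw 2 [← hr2]
        rw [← mul_assoc, H.hinv1, hr1]

theorem unif (H : Hyp S inv z) (f : S → ℝ) (hf : Continuous f) (x₀ : S)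
    (ε : ℝ) (hε : 0 < ε) : ∀ᶠ x in 𝓝 x₀, ∀ y, |f (x * y) - f (x₀ * y)| < ε := by
  by_cases hx : x₀ = z
  · subst hx
    filter_upwards [H.isOpen_zero.mem_nhds rfl] with x hx y
    rw [mem_singleton_iff.1 hx]
    simpa using hε
  have hez : x₀ * inv x₀ ≠ z := fun h => hx (H.eq_zero_of_left _ h)
  have h1 := H.unif_e f hf (x₀ * inv x₀) (H.idl x₀) hez ε hε
  have h2 : Tendsto (fun x => x * inv x₀) (𝓝 x₀) (𝓝 (x₀ * inv x₀)) :=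
    H.tend_mul tendsto_id tendsto_const_nhds
  filter_upwards [h2.eventually h1, (H.isOpen_right (inv x₀ * x₀)).mem_nhds rfl] with x hx hx' y
  have hx' : inv x * x = inv x₀ * x₀ := hx'
  have := hx (x₀ * y)
  have e1 : x * inv x₀ * (x₀ * y) = x * y := by
    calc x * inv x₀ * (x₀ * y) = x * (inv x₀ * x₀) * y := by simp only [mul_assoc]
      _ = x * y := by rw [← hx', ← mul_assoc, H.hinv1]
  have e2 : x₀ * inv x₀ * (x₀ * y) = x₀ * y := by
    rw [← mul_assoc, H.hinv1]
  rwa [e1, e2] at this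

open Classical in
theorem ext_clopen {X Y : Type*} [TopologicalSpace X] [TopologicalSpace Y] (s : Set X)
    (hs : IsClopen s) (h : s → Y) (hh : Continuous h) (c : Y) :
    Continuous fun x => if hx : x ∈ s then h ⟨x, hx⟩ else c := by
  rw [continuous_iff_continuousAt]
  intro x
  by_cases hx : x ∈ s
  · rw [← (hs.2.isOpenEmbedding_subtypeVal).continuousAt_iff (x := ⟨x, hx⟩)]
    refine hh.continuousAt.congr (Eventually.of_forall fun y => ?_)
    simp
  · refine (continuousAt_const (y := c)).congr ?_
    filter_upwards [hs.1.isOpen_compl.mem_nhds hx] with y hy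
    rw [dif_neg hy]

theorem creg (H : Hyp S inv z) : CompletelyRegularSpace S := by
  classical
  rw [completelyRegularSpace_iff_isOpen]
  intro x₀ U hU hxU
  by_cases hx : x₀ = z
  · refine ⟨_, ext_clopen {z} ⟨isClosed_singleton, H.isOpen_zero⟩ (fun _ => 0)
      continuous_const 1, ?_, ?_⟩
    · simp [hx]
    · intro y hy
      have : y ≠ z := by rintro rfl; exact hy (hx ▸ hxU)
      simp [this]
  set e := x₀ * inv x₀ with he
  have hee : e * e = e := H.idl x₀
  have hez : e ≠ z := fun h => hx (H.eq_zero_of_left _ h)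
  let _ := H.grp e hee
  have := H.grp_top e hee
  let _ := IsTopologicalGroup.rightUniformSpace (H.G e)
  have hcr : CompletelyRegularSpace (H.G e) := inferInstance
  have hc : Continuous fun g : H.G e => g.1 * x₀ :=
    H.cont_mul continuous_subtype_val continuous_const
  obtain ⟨h, hh, h0, h1⟩ := completelyRegularSpace_iff_isOpen.1 hcr 1 _ (hU.preimage hc) (by
    change e * x₀ ∈ U
    rw [he, H.hinv1]; exact hxU)
  have hF := (ext_clopen _ (H.G_clopen e) h hh 1).comp
    (H.cont_mul continuous_id (continuous_const (y := inv x₀)))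
  refine ⟨_, hF, ?_, ?_⟩
  · have : x₀ * inv x₀ ∈ {g : S | g * inv g = e ∧ inv g * g = e} := by
      change e * inv e = e ∧ inv e * e = e
      rw [H.inv_idem e hee, hee]; exact ⟨rfl, rfl⟩
    simp only [Function.comp, id]
    rw [dif_pos this]
    exact h0
  · intro y hy
    simp only [Function.comp, id, Pi.one_apply]
    split_ifs with hg
    · apply h1
      intro hmem
      apply hy
      have hmem : y * inv x₀ * x₀ ∈ U := hmem
      have hyy : inv y * y = inv x₀ * x₀ := by
        by_contra hne
        have h3 := H.orth _ _ (H.idr y) (H.idr x₀) hne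
        refine H.G_ne hez ⟨_, hg⟩ ?_
        change y * inv x₀ = z
        calc y * inv x₀ = (y * inv y * y) * (inv x₀ * x₀ * inv x₀) := by rw [H.hinv1, H.hinv2]
          _ = y * ((inv y * y) * (inv x₀ * x₀)) * inv x₀ := by simp only [mul_assoc]
          _ = z := by rw [h3, (H.hz _).2, (H.hz _).1]
      rwa [mul_assoc, ← hyy, ← mul_assoc, H.hinv1] at hmem
    · rfl

end Hyp

/-- Extension of an equicontinuous multiplication to the Stone–Čech compactification. -/
theorem extMul {X : Type*} [TopologicalSpace X] (hcc : CountablyCompact X)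
    (m : X → X → StoneCech X) (hm : ∀ x, Continuous (m x))
    (hu : ∀ φ : StoneCech X → ℝ, Continuous φ → ∀ x₀ ε, 0 < ε →
      ∀ᶠ x in 𝓝 x₀, ∀ y, |φ (m x y) - φ (m x₀ y)| < ε) :
    ∃ M : StoneCech X → StoneCech X → StoneCech X,
      Continuous (fun p : StoneCech X × StoneCech X => M p.1 p.2) ∧
      ∀ x y, M (stoneCechUnit x) (stoneCechUnit y) = m x y := by
  let B := StoneCech X
  let Φ : C(B, ℝ) → X → C(B, ℝ) := fun φ x =>
    φ.comp ⟨stoneCechExtend (hm x), continuous_stoneCechExtend (hm x)⟩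
  have hΦe : ∀ φ x y, Φ φ x (stoneCechUnit y) = φ (m x y) := by
    intro φ x y
    change φ (stoneCechExtend (hm x) (stoneCechUnit y)) = _
    rw [stoneCechExtend_stoneCechUnit]
  have hΦ : ∀ φ, Continuous (Φ φ) := by
    intro φ
    rw [continuous_iff_continuousAt]
    intro x₀
    refine Metric.tendsto_nhds.2 fun ε hε => ?_
    filter_upwards [hu φ φ.continuous x₀ (ε / 2) (by positivity)] with x hx
    refine lt_of_le_of_lt ((ContinuousMap.dist_le (by positivity)).2 ?_) (half_lt_self hε)
    intro b
    refine denseRange_stoneCechUnit.induction_on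
      (p := fun b => dist (Φ φ x b) (Φ φ x₀ b) ≤ ε / 2) b ?_ ?_
    · exact isClosed_le (by fun_prop) continuous_const
    · intro y
      rw [hΦe, hΦe, Real.dist_eq]
      exact (hx y).le
  have hK : ∀ φ, CompactSpace (range (Φ φ)) := fun φ =>
    isCompact_iff_compactSpace.1 (cc_range hcc _ (hΦ φ))
  have hΦ' : ∀ φ, Continuous fun x => (⟨Φ φ x, x, rfl⟩ : range (Φ φ)) := fun φ =>
    (hΦ φ).subtype_mk _
  let Ψ : C(B, ℝ) → B → C(B, ℝ) := fun φ b => (stoneCechExtend (hΦ' φ) b).1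
  have hΨ : ∀ φ, Continuous (Ψ φ) := fun φ =>
    continuous_subtype_val.comp (continuous_stoneCechExtend (hΦ' φ))
  have hΨe : ∀ φ x, Ψ φ (stoneCechUnit x) = Φ φ x := by
    intro φ x
    change (stoneCechExtend (hΦ' φ) (stoneCechUnit x)).1 = _
    rw [stoneCechExtend_stoneCechUnit]
  let T : B × B → C(B, ℝ) → ℝ := fun p φ => Ψ φ p.1 p.2
  have hT : Continuous T := by
    refine continuous_pi fun φ => ?_
    have := hΨ φ
    exact Continuous.eval ((hΨ φ).comp continuous_fst) continuous_snd
  let ι : B → C(B, ℝ) → ℝ := fun b φ => φ b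
  have hι : Continuous ι := continuous_pi fun φ => φ.continuous
  have hinj : Function.Injective ι := by
    intro a b hab
    by_contra hne
    obtain ⟨f, hf, h0, h1⟩ := CompletelyRegularSpace.completely_regular a {b}
      isClosed_singleton hne
    have := congrFun hab ⟨fun x => (f x : ℝ), by fun_prop⟩
    have h2 : (f a : ℝ) = f b := this
    rw [h0, h1 rfl] at h2
    simp at h2
  have hιc : IsClosedEmbedding ι := hι.isClosedEmbedding hinj
  have hmem : ∀ p : B × B, ∃ r, ι r = T p := by
    intro p
    have hd : DenseRange (Prod.map stoneCechUnit stoneCechUnit : X × X → B × B) :=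
      denseRange_stoneCechUnit.prodMap denseRange_stoneCechUnit
    refine hd.induction_on (p := fun p => T p ∈ range ι) p (hιc.isClosed_range.preimage hT) ?_
    rintro ⟨x, y⟩
    refine ⟨m x y, ?_⟩
    ext φ
    change φ (m x y) = Ψ φ (stoneCechUnit x) (stoneCechUnit y)
    rw [hΨe, hΦe]
  choose M hM using hmem
  refine ⟨fun p q => M (p, q), ?_, ?_⟩
  · rw [hιc.isInducing.continuous_iff]
    refine hT.congr fun p => ?_
    exact (hM p).symm
  · intro x y
    apply hinj
    rw [hM]
    ext φ
    change Ψ φ (stoneCechUnit x) (stoneCechUnit y) = φ (m x y)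
    rw [hΨe, hΦe]

end Helpers

/-- The Stone–Čech compactification of a 0-simple countably compact topological
inverse semigroup admits a continuous multiplication and inversion making it a
0-simple topological inverse semigroup, such that the canonical map
`stoneCechUnit : S → βS` is a multiplication- and inversion-preserving topological
embedding. -/
theorem stoneCech_of_zero_simple_countably_compact
    {S : Type*} [Semigroup S] [TopologicalSpace S] [T2Space S]
    (inv : S → S)
    (hinv1 : ∀ a : S, a * inv a * a = a)
    (hinv2 : ∀ a : S, inv a * a * inv a = inv a)
    (hidem : ∀ e f : S, e * e = e → f * f = f → e * f = f * e)
    (hmulc : Continuous fun p : S × S => p.1 * p.2)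
    (hinvc : Continuous inv)
    (hcc : CountablyCompact S)
    (z : S) (hz : ∀ x : S, z * x = z ∧ x * z = z)
    (hSS : ∃ a b : S, a * b ≠ z)
    (hideal : ∀ I : Set S, I.Nonempty →
      (∀ i ∈ I, ∀ s : S, s * i ∈ I ∧ i * s ∈ I) → I = {z} ∨ I = Set.univ) :
    ∃ (mul : StoneCech S → StoneCech S → StoneCech S)
      (inv' : StoneCech S → StoneCech S),
      -- βS is a semigroup
      (∀ a b c : StoneCech S, mul (mul a b) c = mul a (mul b c)) ∧
      -- βS is an inverse semigroup
      (∀ a : StoneCech S, mul (mul a (inv' a)) a = a) ∧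
      (∀ a : StoneCech S, mul (mul (inv' a) a) (inv' a) = inv' a) ∧
      (∀ e f : StoneCech S, mul e e = e → mul f f = f → mul e f = mul f e) ∧
      -- βS is a topological inverse semigroup
      Continuous (fun p : StoneCech S × StoneCech S => mul p.1 p.2) ∧
      Continuous inv' ∧
      -- the image of the zero of S is a zero of βS, and βS is 0-simple
      (∀ x : StoneCech S, mul (stoneCechUnit z) x = stoneCechUnit z ∧
        mul x (stoneCechUnit z) = stoneCechUnit z) ∧
      (∃ a b : StoneCech S, mul a b ≠ stoneCechUnit z) ∧
      (∀ I : Set (StoneCech S), I.Nonempty →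
        (∀ i ∈ I, ∀ s : StoneCech S, mul s i ∈ I ∧ mul i s ∈ I) →
        I = {stoneCechUnit z} ∨ I = Set.univ) ∧
      -- the canonical map preserves multiplication and inversion and is an embedding
      (∀ x y : S, stoneCechUnit (x * y) = mul (stoneCechUnit x) (stoneCechUnit y)) ∧
      (∀ x : S, stoneCechUnit (inv x) = inv' (stoneCechUnit x)) ∧
      Topology.IsEmbedding (stoneCechUnit : S → StoneCech S) := by
  have H : Hyp S inv z := ⟨hinv1, hinv2, hidem, hmulc, hinvc, hcc, hz, hSS, hideal⟩
  have := H.creg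
  have : T35Space S := {}
  have hemb : Topology.IsEmbedding (stoneCechUnit : S → StoneCech S) := isEmbedding_stoneCechUnit
  obtain ⟨mul, hmul, hext⟩ := extMul hcc (fun x y => stoneCechUnit (x * y))
    (fun x => continuous_stoneCechUnit.comp (H.cont_mul continuous_const continuous_id))
    (fun φ hφ x₀ ε hε => H.unif (fun s => φ (stoneCechUnit s))
      (hφ.comp continuous_stoneCechUnit) x₀ ε hε)
  have hi0 : Continuous fun s => (stoneCechUnit (inv s) : StoneCech S) :=
    continuous_stoneCechUnit.comp hinvc
  obtain ⟨inv', hinv', hiext⟩ : ∃ inv' : StoneCech S → StoneCech S, Continuous inv' ∧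
      ∀ x, inv' (stoneCechUnit x) = stoneCechUnit (inv x) :=
    ⟨stoneCechExtend hi0, continuous_stoneCechExtend hi0, stoneCechExtend_stoneCechUnit hi0⟩
  have hd : DenseRange (stoneCechUnit : S → StoneCech S) := denseRange_stoneCechUnit
  have cm : ∀ {X : Type _} [TopologicalSpace X] {f g : X → StoneCech S}, Continuous f →
      Continuous g → Continuous fun x => mul (f x) (g x) :=
    fun hf hg => hmul.comp (hf.prodMk hg)
  have ext1 : ∀ (f g : StoneCech S → StoneCech S), Continuous f → Continuous g →
      (∀ x, f (stoneCechUnit x) = g (stoneCechUnit x)) → ∀ a, f a = g a := by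
    intro f g hf hg h a
    exact hd.induction_on (p := fun a => f a = g a) a (isClosed_eq hf hg) h
  have ext2 : ∀ (f g : StoneCech S × StoneCech S → StoneCech S), Continuous f → Continuous g →
      (∀ x y, f (stoneCechUnit x, stoneCechUnit y) = g (stoneCechUnit x, stoneCechUnit y)) →
      ∀ a b, f (a, b) = g (a, b) := by
    intro f g hf hg h a b
    exact hd.induction_on₂ (p := fun a b => f (a, b) = g (a, b)) (isClosed_eq hf hg) h a b
  have hassoc : ∀ a b c : StoneCech S, mul (mul a b) c = mul a (mul b c) := by
    intro a b c
    refine hd.induction_on₃ (p := fun a b c => mul (mul a b) c = mul a (mul b c)) ?_ ?_ a b c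
    · refine isClosed_eq (cm (cm ?_ ?_) ?_) (cm ?_ (cm ?_ ?_)) <;> fun_prop
    · intro x y w
      simp only [hext, mul_assoc]
  have hI1 : ∀ a, mul (mul a (inv' a)) a = a :=
    ext1 _ _ (cm (cm continuous_id hinv') continuous_id) continuous_id
      (fun x => by simp only [hiext, hext, hinv1])
  have hI2 : ∀ a, mul (mul (inv' a) a) (inv' a) = inv' a :=
    ext1 _ _ (cm (cm hinv' continuous_id) hinv') hinv'
      (fun x => by simp only [hiext, hext, hinv2])
  have hII : ∀ a, inv' (inv' a) = a :=
    ext1 _ _ (hinv'.comp hinv') continuous_id (fun x => by simp only [hiext, H.inv_inv])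
  have hIm : ∀ a b, inv' (mul a b) = mul (inv' b) (inv' a) :=
    ext2 (fun p => inv' (mul p.1 p.2)) (fun p => mul (inv' p.2) (inv' p.1))
      (hinv'.comp hmul) (cm (hinv'.comp continuous_snd) (hinv'.comp continuous_fst))
      (fun x y => by simp only [hiext, hext, H.inv_mul])
  have hcomm : ∀ a b, mul (mul a (inv' a)) (mul b (inv' b))
      = mul (mul b (inv' b)) (mul a (inv' a)) :=
    ext2 (fun p => mul (mul p.1 (inv' p.1)) (mul p.2 (inv' p.2)))
      (fun p => mul (mul p.2 (inv' p.2)) (mul p.1 (inv' p.1)))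
      (cm (cm continuous_fst (hinv'.comp continuous_fst))
        (cm continuous_snd (hinv'.comp continuous_snd)))
      (cm (cm continuous_snd (hinv'.comp continuous_snd))
        (cm continuous_fst (hinv'.comp continuous_fst)))
      (fun x y => by simp only [hiext, hext]; rw [hidem _ _ (H.idl x) (H.idl y)])
  -- idempotents of the compactification have the form `a * a⁻¹`
  have hidf : ∀ e, mul e e = e → e = mul e (inv' e) := by
    intro e he
    have he' : mul (inv' e) (inv' e) = inv' e := by rw [← hIm, he]
    have h1 : inv' e = e := by
      have hc := hcomm (inv' e) e
      rw [hII] at hc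
      have l : mul (mul (inv' e) e) (mul e (inv' e)) = inv' e := by
        rw [hassoc, ← hassoc e e, he, ← hassoc, hI2]
      have r : mul (mul e (inv' e)) (mul (inv' e) e) = e := by
        rw [hassoc, ← hassoc (inv' e) (inv' e), he', ← hassoc, hI1]
      rw [← l, hc, r]
    rw [h1, he]
  have hz1 : ∀ x, mul (stoneCechUnit z) x = stoneCechUnit z :=
    ext1 _ _ (cm continuous_const continuous_id) continuous_const
      (fun x => by rw [hext, (hz x).1])
  have hz2 : ∀ x, mul x (stoneCechUnit z) = stoneCechUnit z :=
    ext1 _ _ (cm continuous_id continuous_const) continuous_const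
      (fun x => by rw [hext, (hz x).2])
  have hfin : ∀ a, ∃ e : S, e * e = e ∧ stoneCechUnit e = mul a (inv' a) := by
    intro a
    have hcl : IsClosed ((stoneCechUnit : S → StoneCech S) '' {e : S | e * e = e}) :=
      (H.finite_idem.image _).isClosed
    exact hd.induction_on
      (p := fun a => mul a (inv' a) ∈ (stoneCechUnit : S → StoneCech S) '' {e : S | e * e = e}) a
      (hcl.preimage (cm continuous_id hinv'))
      (fun x => ⟨x * inv x, H.idl x, by rw [hiext, hext]⟩)
  refine ⟨mul, inv', hassoc, hI1, hI2, ?_, hmul, hinv', fun x => ⟨hz1 x, hz2 x⟩, ?_, ?_,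
    fun x y => (hext x y).symm, fun x => (hiext x).symm, hemb⟩
  · intro e f he hf
    rw [hidf e he, hidf f hf, hcomm]
  · obtain ⟨a, b, hab⟩ := hSS
    refine ⟨stoneCechUnit a, stoneCechUnit b, fun h => hab ?_⟩
    rw [hext] at h
    exact hemb.injective h
  · intro I hI hIi
    by_cases hall : ∀ p ∈ I, p = stoneCechUnit z
    · left
      obtain ⟨p, hp⟩ := hI
      refine Set.Subset.antisymm hall ?_
      rintro _ rfl
      rw [← hall p hp]; exact hp
    · right
      push Not at hall
      obtain ⟨p, hp, hpz⟩ := hall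
      obtain ⟨e, he, hep⟩ := hfin p
      have hez : e ≠ z := by
        rintro rfl
        apply hpz
        rw [← hI1 p, ← hep, hz1]
      have heI : stoneCechUnit e ∈ I := by rw [hep]; exact (hIi p hp _).2
      rw [Set.eq_univ_iff_forall]
      intro q
      obtain ⟨f, hf, hfq⟩ := hfin q
      obtain ⟨x, y, hxy⟩ := H.exists_mul e hez (Or.inr he) f
      rw [← hI1 q, ← hfq, hxy, ← hext, ← hext]
      exact (hIi _ (hIi _ (hIi _ heI _).1 _).2 _).2
end
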